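/- (Backward optimality characterization) A repair sequence σ (with j_p = σ(p) for p ≥ 1 and j_0 = 0) is optimal, i.e., T(σ) = min over all repair sequences τ of T(τ), if and only if for every p ∈ {1,…,n}: v(j_{p−1}, {j_p,…,j_n}) = W({j_1,…,j_{p−1}}) · d(j_{p−1}, j_p) + v(j_p, {j_{p+1},…,j_n}). -/

import Mathlib

/-- `W n pre S` is the number of vertices of `V_c = {1,…,n}` without power service
when exactly the vertices in `S` have been repaired: vertices `j` having some
predecessor-or-self `i` (i.e. `pre i j`) that is not in `S`. -/
noncomputable def W (n : ℕ) (pre : ℕ → ℕ → Prop) (S : Finset ℕ) : ℕ :=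
  {j | j ∈ Finset.Icc 1 n ∧ ∃ i ∈ Finset.Icc 1 n, pre i j ∧ i ∉ S}.ncard

/-- `jseq σ p` is the `p`-th visited vertex: the depot `0` for `p = 0`, and `σ p` otherwise. -/
def jseq (σ : ℕ → ℕ) (p : ℕ) : ℕ := if p = 0 then 0 else σ p

/-- Arrival time at the `p`-th visited vertex: `t_p = ∑_{q=1}^p d(j_{q-1}, j_q)`. -/
def arrival (d : ℕ → ℕ → ℝ) (σ : ℕ → ℕ) (p : ℕ) : ℝ :=
  ∑ q ∈ Finset.Icc 1 p, d (jseq σ (q - 1)) (jseq σ q)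

/-- `lastPos n pre σ i = max { p ∈ [1,n] : σ p ⪰ i }`, the position at which the
service of vertex `i` is restored. -/
noncomputable def lastPos (n : ℕ) (pre : ℕ → ℕ → Prop) (σ : ℕ → ℕ) (i : ℕ) : ℕ :=
  sSup {p : ℕ | p ∈ Finset.Icc 1 n ∧ pre (σ p) i}

/-- Total service disruption time `T(σ) = ∑_{i ∈ V_c} r_i` where `r_i = t_{p(i)}`. -/
noncomputable def totalT (n : ℕ) (d : ℕ → ℕ → ℝ) (pre : ℕ → ℕ → Prop) (σ : ℕ → ℕ) : ℝ :=
  ∑ i ∈ Finset.Icc 1 n, arrival d σ (lastPos n pre σ i)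

/-- Backward value function `v(k, Y)`: the minimum over all orderings `(y_1,…,y_m)` of `Y`
(with `m = |Y|` and `y_0 = k`) of `∑_{p=1}^{m} W(V_c ∖ {y_p,…,y_m}) · d(y_{p−1}, y_p)`;
in particular `v(k, ∅) = 0`. -/
noncomputable def vval (n : ℕ) (d : ℕ → ℕ → ℝ) (pre : ℕ → ℕ → Prop) (k : ℕ) (Y : Finset ℕ) : ℝ :=
  sInf { c : ℝ | ∃ y : ℕ → ℕ, Set.BijOn y (Set.Icc 1 Y.card) ↑Y ∧
    c = ∑ p ∈ Finset.Icc 1 Y.card,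
      (W n pre (Finset.Icc 1 n \ (Finset.Icc p Y.card).image y) : ℝ) *
        d (if p = 1 then k else y (p - 1)) (y p) }

/-- The cost incurred by the repair sequence `σ` from its `(k+1)`-st travel leg onwards, each leg
being weighted by the number of vertices without service while it is travelled. -/
noncomputable def tailCost (n : ℕ) (d : ℕ → ℕ → ℝ) (pre : ℕ → ℕ → Prop) (σ : ℕ → ℕ) (k : ℕ) : ℝ :=
  ∑ q ∈ Finset.Icc (k + 1) n,
    (W n pre ((Finset.Icc 1 (q - 1)).image σ) : ℝ) * d (jseq σ (q - 1)) (σ q)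

lemma le_lastPos_iff {n : ℕ} {pre : ℕ → ℕ → Prop} {σ : ℕ → ℕ} {i q : ℕ} (hq : 1 ≤ q) :
    q ≤ lastPos n pre σ i ↔ ∃ p, q ≤ p ∧ p ≤ n ∧ pre (σ p) i := by
  have hb : BddAbove {p : ℕ | p ∈ Finset.Icc 1 n ∧ pre (σ p) i} :=
    ⟨n, fun p hp => (Finset.mem_Icc.mp hp.1).2⟩
  constructor
  · intro h
    have hne : {p : ℕ | p ∈ Finset.Icc 1 n ∧ pre (σ p) i}.Nonempty := by
      by_contra hc
      rw [Set.not_nonempty_iff_eq_empty] at hc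
      rw [lastPos, hc] at h
      simp at h
      omega
    obtain ⟨h1, h2⟩ := Nat.sSup_mem hne hb
    exact ⟨_, h, (Finset.mem_Icc.mp h1).2, h2⟩
  · rintro ⟨p, hqp, hpn, hp⟩
    exact hqp.trans (le_csSup hb ⟨Finset.mem_Icc.mpr ⟨hq.trans hqp, hpn⟩, hp⟩)

lemma lastPos_le {n : ℕ} {pre : ℕ → ℕ → Prop} {σ : ℕ → ℕ} {i : ℕ} : lastPos n pre σ i ≤ n := by
  by_contra! h
  obtain ⟨p, h1, h2, -⟩ := (le_lastPos_iff (q := n + 1) (by omega)).mp h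
  omega

/-- Before the `q`-th repair, the vertices without service are those restored at position `q`
or later. -/
lemma W_image_eq {n : ℕ} {pre : ℕ → ℕ → Prop} {σ : ℕ → ℕ}
    (hσ : Set.BijOn σ (Set.Icc 1 n) (Set.Icc 1 n)) {q : ℕ} (hq : 1 ≤ q) :
    W n pre ((Finset.Icc 1 (q - 1)).image σ) =
      ((Finset.Icc 1 n).filter fun i => q ≤ lastPos n pre σ i).card := by
  rw [W, ← Set.ncard_coe_finset]
  congr 1
  ext i
  simp only [Set.mem_ofPred_eq, Finset.coe_filter, le_lastPos_iff hq]
  refine and_congr_right fun _ => ⟨?_, ?_⟩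
  · rintro ⟨j, hj, hji, hjn⟩
    obtain ⟨p, hp, rfl⟩ := hσ.surjOn (by simpa using hj : j ∈ Set.Icc 1 n)
    refine ⟨p, ?_, hp.2, hji⟩
    by_contra! hpq
    exact hjn (Finset.mem_image_of_mem σ (Finset.mem_Icc.mpr ⟨hp.1, by omega⟩))
  · rintro ⟨p, hqp, hpn, hp⟩
    have hp' : p ∈ Set.Icc 1 n := ⟨hq.trans hqp, hpn⟩
    refine ⟨σ p, by simpa using hσ.mapsTo hp', hp, ?_⟩
    simp only [Finset.mem_image, Finset.mem_Icc, not_exists, not_and]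
    intro r hr hrp
    have := hσ.injOn (⟨hr.1, by omega⟩ : r ∈ Set.Icc 1 n) hp' hrp
    omega

lemma totalT_eq_tailCost {n : ℕ} (d : ℕ → ℕ → ℝ) (pre : ℕ → ℕ → Prop) {σ : ℕ → ℕ}
    (hσ : Set.BijOn σ (Set.Icc 1 n) (Set.Icc 1 n)) :
    totalT n d pre σ = tailCost n d pre σ 0 := by
  have harr : ∀ i, arrival d σ (lastPos n pre σ i) = ∑ q ∈ Finset.Icc 1 n,
      if q ≤ lastPos n pre σ i then d (jseq σ (q - 1)) (jseq σ q) else 0 := by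
    intro i
    rw [arrival, ← Finset.sum_filter]
    refine Finset.sum_congr ?_ fun _ _ => rfl
    ext q
    have := lastPos_le (n := n) (pre := pre) (σ := σ) (i := i)
    simp only [Finset.mem_Icc, Finset.mem_filter]
    omega
  simp only [totalT, tailCost, harr]
  rw [Finset.sum_comm]
  refine Finset.sum_congr rfl fun q hq => ?_
  have hq1 : 1 ≤ q := (Finset.mem_Icc.mp hq).1
  rw [W_image_eq hσ hq1, ← Finset.sum_filter, Finset.sum_const, nsmul_eq_mul]
  rw [show jseq σ q = σ q from if_neg (by omega)]

lemma card_image_Icc {n : ℕ} {σ : ℕ → ℕ} (hσ : Set.BijOn σ (Set.Icc 1 n) (Set.Icc 1 n)) (k : ℕ) :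
    ((Finset.Icc (k + 1) n).image σ).card = n - k := by
  rw [Finset.card_image_of_injOn, Nat.card_Icc]
  · omega
  · exact hσ.injOn.mono fun x hx => by
      simp only [Finset.coe_Icc, Set.mem_Icc] at hx ⊢
      omega

lemma sdiff_image_Icc {n k : ℕ} {τ y : ℕ → ℕ}
    (hτ : Set.BijOn τ (Set.Icc 1 n) (Set.Icc 1 n))
    (hy : ∀ i ∈ Set.Icc 1 (n - k), y i = τ (k + i)) {i : ℕ} (hi : i ∈ Set.Icc 1 (n - k)) :
    Finset.Icc 1 n \ (Finset.Icc i (n - k)).image y = (Finset.Icc 1 (k + i - 1)).image τ := by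
  obtain ⟨hi1, hi2⟩ := hi
  ext x
  simp only [Finset.mem_sdiff, Finset.mem_image, Finset.mem_Icc, not_exists, not_and]
  constructor
  · rintro ⟨hx, hxy⟩
    obtain ⟨p, ⟨hp1, hpn⟩, rfl⟩ := hτ.surjOn (show x ∈ Set.Icc 1 n from hx)
    refine ⟨p, ⟨hp1, ?_⟩, rfl⟩
    by_contra! hlt
    refine hxy (p - k) ⟨by omega, by omega⟩ ?_
    rw [hy _ ⟨by omega, by omega⟩]
    congr 1
    omega
  · rintro ⟨p, ⟨hp1, hp2⟩, rfl⟩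
    have hp : p ∈ Set.Icc 1 n := ⟨hp1, by omega⟩
    refine ⟨hτ.mapsTo hp, fun r hr hrp => ?_⟩
    rw [hy _ ⟨by omega, hr.2⟩] at hrp
    have := hτ.injOn ⟨by omega, by omega⟩ hp hrp
    omega

/-- The cost of an ordering `y`, as it appears in the definition of `vval`, is the tail cost of
any repair sequence that ends with `y`. -/
lemma sum_eq_tailCost {n k : ℕ} (d : ℕ → ℕ → ℝ) (pre : ℕ → ℕ → Prop) {τ y : ℕ → ℕ}
    (hk : k ≤ n) (hτ : Set.BijOn τ (Set.Icc 1 n) (Set.Icc 1 n))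
    (hy : ∀ i ∈ Set.Icc 1 (n - k), y i = τ (k + i)) :
    ∑ p ∈ Finset.Icc 1 (n - k),
      (W n pre (Finset.Icc 1 n \ (Finset.Icc p (n - k)).image y) : ℝ) *
        d (if p = 1 then jseq τ k else y (p - 1)) (y p) = tailCost n d pre τ k := by
  refine Finset.sum_nbij' (fun i => k + i) (fun q => q - k) ?_ ?_ ?_ ?_ ?_
  · intro i hi
    simp only [Finset.mem_Icc] at hi ⊢
    omega
  · intro q hq
    simp only [Finset.mem_Icc] at hq ⊢
    omega
  · intro i _
    exact Nat.add_sub_cancel_left ..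
  · intro q hq
    simp only [Finset.mem_Icc] at hq
    show k + (q - k) = q
    omega
  · intro i hi
    have hi' : i ∈ Set.Icc 1 (n - k) := by simpa using hi
    rw [sdiff_image_Icc hτ hy hi', hy i hi']
    obtain ⟨hi1, hi2⟩ := hi'
    congr 2
    split_ifs with h
    · subst h
      rfl
    · rw [hy _ ⟨by omega, by omega⟩, jseq, if_neg (by omega)]
      congr 1
      omega

lemma vval_le {n : ℕ} {d : ℕ → ℕ → ℝ} (hd : ∀ i j, 0 ≤ d i j) (pre : ℕ → ℕ → Prop) (k : ℕ)
    {Y : Finset ℕ} {y : ℕ → ℕ} (hy : Set.BijOn y (Set.Icc 1 Y.card) ↑Y) :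
    vval n d pre k Y ≤ ∑ p ∈ Finset.Icc 1 Y.card,
      (W n pre (Finset.Icc 1 n \ (Finset.Icc p Y.card).image y) : ℝ) *
        d (if p = 1 then k else y (p - 1)) (y p) := by
  refine csInf_le ⟨0, ?_⟩ ⟨y, hy, rfl⟩
  rintro c ⟨z, -, rfl⟩
  exact Finset.sum_nonneg fun p _ => mul_nonneg (Nat.cast_nonneg _) (hd _ _)

lemma bijOn_shift {n k : ℕ} {σ : ℕ → ℕ} (hσ : Set.BijOn σ (Set.Icc 1 n) (Set.Icc 1 n)) :
    Set.BijOn (fun i => σ (k + i)) (Set.Icc 1 (n - k)) ↑((Finset.Icc (k + 1) n).image σ) := by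
  refine ⟨?_, ?_, ?_⟩
  · rintro i ⟨hi1, hi2⟩
    exact Finset.mem_coe.mpr
      (Finset.mem_image_of_mem σ (Finset.mem_Icc.mpr ⟨by omega, by omega⟩))
  · rintro i ⟨hi1, hi2⟩ j ⟨hj1, hj2⟩ hij
    have := hσ.injOn ⟨by omega, by omega⟩ ⟨by omega, by omega⟩ hij
    omega
  · intro x hx
    obtain ⟨p, hp, rfl⟩ := Finset.mem_image.mp (Finset.mem_coe.mp hx)
    rw [Finset.mem_Icc] at hp
    refine ⟨p - k, ⟨by omega, by omega⟩, ?_⟩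
    show σ (k + (p - k)) = σ p
    congr 1
    omega

lemma vval_le_tailCost {n k : ℕ} {d : ℕ → ℕ → ℝ} (hd : ∀ i j, 0 ≤ d i j) (pre : ℕ → ℕ → Prop)
    {σ : ℕ → ℕ} (hk : k ≤ n) (hσ : Set.BijOn σ (Set.Icc 1 n) (Set.Icc 1 n)) :
    vval n d pre (jseq σ k) ((Finset.Icc (k + 1) n).image σ) ≤ tailCost n d pre σ k := by
  have hcard := card_image_Icc hσ k
  have h := vval_le (n := n) hd pre (jseq σ k) (Y := (Finset.Icc (k + 1) n).image σ)
    (y := fun i => σ (k + i)) (hcard ▸ bijOn_shift hσ)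
  rwa [hcard, sum_eq_tailCost d pre hk hσ fun _ _ => rfl] at h

/-- Replacing the tail of a repair sequence by another ordering of the same vertices. -/
lemma bijOn_splice {n k : ℕ} {σ y : ℕ → ℕ} (hk : k ≤ n)
    (hσ : Set.BijOn σ (Set.Icc 1 n) (Set.Icc 1 n))
    (hy : Set.BijOn y (Set.Icc 1 (n - k)) ↑((Finset.Icc (k + 1) n).image σ)) :
    Set.BijOn (fun q => if q ≤ k then σ q else y (q - k)) (Set.Icc 1 n) (Set.Icc 1 n) := by
  have hmaps : Set.MapsTo (fun q => if q ≤ k then σ q else y (q - k))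
      (Set.Icc 1 n) (Set.Icc 1 n) := by
    rintro q ⟨hq1, hqn⟩
    dsimp only
    split_ifs with h
    · exact hσ.mapsTo ⟨hq1, hqn⟩
    · obtain ⟨p, hp, hpq⟩ := Finset.mem_image.mp
        (Finset.mem_coe.mp (hy.mapsTo (⟨by omega, by omega⟩ : q - k ∈ Set.Icc 1 (n - k))))
      rw [Finset.mem_Icc] at hp
      rw [← hpq]
      exact hσ.mapsTo ⟨by omega, hp.2⟩
  have hsurj : Set.SurjOn (fun q => if q ≤ k then σ q else y (q - k))
      (Set.Icc 1 n) (Set.Icc 1 n) := by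
    intro x hx
    obtain ⟨p, ⟨hp1, hpn⟩, rfl⟩ := hσ.surjOn hx
    by_cases h : p ≤ k
    · exact ⟨p, ⟨hp1, hpn⟩, if_pos h⟩
    · obtain ⟨i, ⟨hi1, hi2⟩, hi⟩ := hy.surjOn (Finset.mem_coe.mpr
        (Finset.mem_image_of_mem σ (Finset.mem_Icc.mpr ⟨by omega, hpn⟩)))
      refine ⟨k + i, ⟨by omega, by omega⟩, ?_⟩
      dsimp only
      rw [if_neg (by omega), Nat.add_sub_cancel_left, hi]
  refine ⟨hmaps, ?_, hsurj⟩
  have h := Finset.injOn_of_surjOn_of_card_le (s := Finset.Icc 1 n) (t := Finset.Icc 1 n)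
    (fun q => if q ≤ k then σ q else y (q - k)) (by simpa using hmaps) (by simpa using hsurj) le_rfl
  simpa using h

lemma tailCost_zero_eq {n k : ℕ} (d : ℕ → ℕ → ℝ) (pre : ℕ → ℕ → Prop) (σ : ℕ → ℕ) (hk : k ≤ n) :
    tailCost n d pre σ 0 = ∑ q ∈ Finset.Icc 1 k,
      (W n pre ((Finset.Icc 1 (q - 1)).image σ) : ℝ) * d (jseq σ (q - 1)) (σ q)
        + tailCost n d pre σ k := by
  simp only [tailCost, zero_add]
  rw [← Finset.sum_union]
  · refine Finset.sum_congr ?_ fun _ _ => rfl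
    ext q
    simp only [Finset.mem_union, Finset.mem_Icc]
    omega
  · rw [Finset.disjoint_left]
    intro q
    simp only [Finset.mem_Icc]
    omega

lemma tailCost_eq_add {n k : ℕ} (d : ℕ → ℕ → ℝ) (pre : ℕ → ℕ → Prop) (σ : ℕ → ℕ) (hk : k < n) :
    tailCost n d pre σ k = (W n pre ((Finset.Icc 1 k).image σ) : ℝ) * d (jseq σ k) (σ (k + 1))
      + tailCost n d pre σ (k + 1) := by
  rw [tailCost, ← Finset.insert_Icc_add_one_left_eq_Icc (by omega), Finset.sum_insert (by simp)]
  rfl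

lemma tailCost_congr_head {n k : ℕ} (d : ℕ → ℕ → ℝ) (pre : ℕ → ℕ → Prop) {σ τ : ℕ → ℕ}
    (hk : k ≤ n) (h : ∀ q ≤ k, τ q = σ q) :
    tailCost n d pre τ 0 - tailCost n d pre τ k = tailCost n d pre σ 0 - tailCost n d pre σ k := by
  rw [tailCost_zero_eq d pre τ hk, tailCost_zero_eq d pre σ hk, add_sub_cancel_right,
    add_sub_cancel_right]
  refine Finset.sum_congr rfl fun q hq => ?_
  rw [Finset.mem_Icc] at hq
  have himage : (Finset.Icc 1 (q - 1)).image τ = (Finset.Icc 1 (q - 1)).image σ :=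
    Finset.image_congr fun r hr => h r (by
      simp only [Finset.coe_Icc, Set.mem_Icc] at hr
      omega)
  have hjseq : jseq τ (q - 1) = jseq σ (q - 1) := by
    simp only [jseq, h (q - 1) (by omega)]
  rw [h q hq.2, himage, hjseq]

/-- Every tail of an optimal repair sequence is optimal. -/
lemma vval_eq_tailCost_of_optimal {n k : ℕ} {d : ℕ → ℕ → ℝ} (hd : ∀ i j, 0 ≤ d i j)
    {pre : ℕ → ℕ → Prop} {σ : ℕ → ℕ} (hk : k ≤ n)
    (hσ : Set.BijOn σ (Set.Icc 1 n) (Set.Icc 1 n))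
    (hopt : ∀ τ : ℕ → ℕ, Set.BijOn τ (Set.Icc 1 n) (Set.Icc 1 n) →
      totalT n d pre σ ≤ totalT n d pre τ) :
    vval n d pre (jseq σ k) ((Finset.Icc (k + 1) n).image σ) = tailCost n d pre σ k := by
  refine le_antisymm (vval_le_tailCost hd pre hk hσ) ?_
  rw [vval, card_image_Icc hσ k]
  refine le_csInf ⟨_, _, bijOn_shift hσ, rfl⟩ ?_
  rintro c ⟨y, hy, rfl⟩
  set τ : ℕ → ℕ := fun q => if q ≤ k then σ q else y (q - k) with hτdef
  have hτ : Set.BijOn τ (Set.Icc 1 n) (Set.Icc 1 n) := bijOn_splice hk hσ hy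
  have hhead : ∀ q ≤ k, τ q = σ q := fun q hq => if_pos hq
  have hj : jseq σ k = jseq τ k := by rw [jseq, jseq, hhead k le_rfl]
  have hyτ : ∀ i ∈ Set.Icc 1 (n - k), y i = τ (k + i) := by
    rintro i ⟨hi, -⟩
    rw [hτdef]
    dsimp only
    rw [if_neg (by omega), Nat.add_sub_cancel_left]
  rw [hj, sum_eq_tailCost d pre hk hτ hyτ]
  have h1 := hopt τ hτ
  rw [totalT_eq_tailCost d pre hσ, totalT_eq_tailCost d pre hτ] at h1
  have h2 := tailCost_congr_head d pre hk hhead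
  linarith

lemma vval_empty (n : ℕ) (d : ℕ → ℕ → ℝ) (pre : ℕ → ℕ → Prop) (k : ℕ) :
    vval n d pre k ∅ = 0 := by
  simp [vval, Set.BijOn, Set.MapsTo, Set.SurjOn]

/-- **Backward optimality characterization.** A repair sequence `σ` is
optimal if and only if for every `p ∈ {1,…,n}`,
`v(j_{p−1}, {j_p,…,j_n}) = W({j_1,…,j_{p−1}}) · d(j_{p−1}, j_p) + v(j_p, {j_{p+1},…,j_n})`. -/
theorem stmt15
    (n : ℕ) (hn : 1 ≤ n)
    (d : ℕ → ℕ → ℝ) (hd : ∀ i j, 0 ≤ d i j)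
    (pre : ℕ → ℕ → Prop)
    (hrefl : ∀ i ∈ Finset.Icc 1 n, pre i i)
    (htrans : ∀ i j k, pre i j → pre j k → pre i k)
    (hantisymm : ∀ i j, pre i j → pre j i → i = j)
    (σ : ℕ → ℕ) (hσ : Set.BijOn σ (Set.Icc 1 n) (Set.Icc 1 n))
    :
    (∀ τ : ℕ → ℕ, Set.BijOn τ (Set.Icc 1 n) (Set.Icc 1 n) →
        totalT n d pre σ ≤ totalT n d pre τ)
      ↔ ∀ p ∈ Finset.Icc 1 n,
          vval n d pre (jseq σ (p - 1)) ((Finset.Icc p n).image σ)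
            = (W n pre ((Finset.Icc 1 (p - 1)).image σ) : ℝ) * d (jseq σ (p - 1)) (σ p)
              + vval n d pre (σ p) ((Finset.Icc (p + 1) n).image σ) := by
  have hjs : ∀ k, jseq σ (k + 1) = σ (k + 1) := fun k => if_neg (by omega)
  constructor
  · intro hopt p hp
    obtain ⟨k, rfl⟩ := Nat.exists_eq_add_of_le' (Finset.mem_Icc.mp hp).1
    have hkn : k + 1 ≤ n := (Finset.mem_Icc.mp hp).2
    rw [Nat.add_sub_cancel, ← hjs k, vval_eq_tailCost_of_optimal hd (by omega) hσ hopt,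
      vval_eq_tailCost_of_optimal hd hkn hσ hopt, hjs k]
    exact tailCost_eq_add d pre σ hkn
  · intro h τ hτ
    have hv : ∀ m ≤ n, vval n d pre (jseq σ (n - m)) ((Finset.Icc (n - m + 1) n).image σ)
        = tailCost n d pre σ (n - m) := by
      intro m
      induction m with
      | zero => simp [tailCost, vval_empty]
      | succ m ih =>
        intro hm
        have hm' : n - m = n - (m + 1) + 1 := by omega
        have ih' := ih (by omega)
        rw [hm', hjs] at ih'
        have hp := h (n - (m + 1) + 1) (Finset.mem_Icc.mpr ⟨by omega, by omega⟩)
        rw [Nat.add_sub_cancel, ih'] at hp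
        rw [hp, tailCost_eq_add d pre σ (k := n - (m + 1)) (by omega)]
    have himage : ∀ ρ : ℕ → ℕ, Set.BijOn ρ (Set.Icc 1 n) (Set.Icc 1 n) →
        (Finset.Icc (0 + 1) n).image ρ = Finset.Icc 1 n := by
      intro ρ hρ
      rw [← Finset.coe_inj]
      simpa using hρ.image_eq
    have h0 := hv n le_rfl
    have h1 := vval_le_tailCost hd pre (Nat.zero_le n) hτ
    rw [Nat.sub_self, himage σ hσ] at h0
    rw [himage τ hτ] at h1
    rw [totalT_eq_tailCost d pre hσ, totalT_eq_tailCost d pre hτ, ← h0]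
    exact h1
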